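/- arXiv:1202.5052 — 8 statements merged into one kernel-verified Lean document; each statement's English description precedes it below -/
import Mathlib

section
/- Let N ≥ 2, k ≥ 0, and let Ω = {x ∈ ℝ^N : x_i ≠ x_j for all i ≠ j}. Suppose u : (0,∞) × Ω → ℝ is once continuously differentiable in t and twice continuously differentiable in x, and satisfies for all (t,x) ∈ (0,∞) × Ω the type-A Dunkl backward equation ∂u/∂t = (1/2)∑_{i=1}^N ∂²u/∂x_i² + k ∑_{i=1}^N ∑_{j≠i} (x_i−x_j)^{-1} ∂u/∂x_i − (k/2) ∑_{i=1}^N ∑_{j≠i} [u(t,x) − u(t,σ_{ij}x)]/(x_i−x_j)². Then the symmetrized function U(t,x) := ∑_{ρ∈S_N} u(t,ρx) satisfies Dyson's backward equation ∂U/∂t = (1/2)∑_{i=1}^N ∂²U/∂x_i² + k ∑_{i=1}^N ∑_{j≠i} (x_i−x_j)^{-1} ∂U/∂x_i for all (t,x) ∈ (0,∞) × Ω. -/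
open Set

section PermutedCoordinates

variable {ι : Type*} [Fintype ι]

/-- The set of points with pairwise distinct coordinates is open. -/
theorem isOpen_setOf_pairwise_ne :
    IsOpen {x : ι → ℝ | ∀ i j : ι, i ≠ j → x i ≠ x j} := by
  simp only [ofPred_forall]
  exact isOpen_iInter_of_finite fun i => isOpen_iInter_of_finite fun j =>
    isOpen_iInter_of_finite fun _ => isOpen_ne_fun (continuous_apply i) (continuous_apply j)

/-- Precomposition with a permutation of the coordinates preserves differentiability. -/
theorem DifferentiableAt.comp_perm {f : (ι → ℝ) → ℝ} {ρ : Equiv.Perm ι} {x : ι → ℝ}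
    (hf : DifferentiableAt ℝ f (x ∘ ρ)) :
    DifferentiableAt ℝ (fun z : ι → ℝ => f (z ∘ ρ)) x := by
  have hρ : DifferentiableAt ℝ (fun z : ι → ℝ => z ∘ ρ) x :=
    differentiableAt_pi.2 fun j => differentiableAt_apply (ρ j) x
  exact DifferentiableAt.comp x hf hρ

variable [DecidableEq ι]

/-- Permuting coordinates permutes the partial derivatives. -/
theorem fderiv_comp_perm_single (f : (ι → ℝ) → ℝ) (ρ : Equiv.Perm ι) (i : ι) (x : ι → ℝ) :
    fderiv ℝ (fun z : ι → ℝ => f (z ∘ ρ)) x (Pi.single i 1) =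
      fderiv ℝ f (x ∘ ρ) (Pi.single (ρ.symm i) 1) := by
  let L : (ι → ℝ) ≃L[ℝ] (ι → ℝ) :=
    (LinearEquiv.funCongrLeft ℝ ℝ ρ).toContinuousLinearEquiv
  have hL : ∀ z, L z = z ∘ ρ := fun z => rfl
  have h : fderiv ℝ (fun z : ι → ℝ => f (z ∘ ρ)) x =
      (fderiv ℝ f (L x)).comp (L : (ι → ℝ) →L[ℝ] (ι → ℝ)) := L.comp_right_fderiv
  have hs : L (Pi.single i 1) = Pi.single (ρ.symm i) 1 := by
    ext j
    simp [hL, Pi.single_apply, Equiv.eq_symm_apply]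
  rw [h, ContinuousLinearMap.comp_apply, ContinuousLinearEquiv.coe_coe, hs, hL]

/-- The partial derivatives of the symmetrization of a function. -/
theorem fderiv_sum_comp_perm_single {f : (ι → ℝ) → ℝ} {x : ι → ℝ}
    (hf : ∀ ρ : Equiv.Perm ι, DifferentiableAt ℝ f (x ∘ ρ)) (i : ι) :
    fderiv ℝ (fun z : ι → ℝ => ∑ ρ : Equiv.Perm ι, f (z ∘ ρ)) x (Pi.single i 1) =
      ∑ ρ : Equiv.Perm ι, fderiv ℝ f (x ∘ ρ) (Pi.single (ρ.symm i) 1) := by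
  rw [fderiv_fun_sum fun ρ _ => (hf ρ).comp_perm, _root_.sum_apply]
  exact Finset.sum_congr rfl fun ρ _ => fderiv_comp_perm_single f ρ i x

/-- The Laplacian of the symmetrization of a `C²` function on an open set which is
stable under permutations of the coordinates. -/
theorem laplacian_sum_comp_perm {f : (ι → ℝ) → ℝ} {s : Set (ι → ℝ)} (hs : IsOpen s)
    (hperm : ∀ x ∈ s, ∀ ρ : Equiv.Perm ι, x ∘ ρ ∈ s) (hf : ContDiffOn ℝ 2 f s)
    {x : ι → ℝ} (hx : x ∈ s) :
    ∑ i, fderiv ℝ (fun y => fderiv ℝ (fun z : ι → ℝ => ∑ ρ : Equiv.Perm ι, f (z ∘ ρ))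
        y (Pi.single i 1)) x (Pi.single i 1) =
      ∑ ρ : Equiv.Perm ι, ∑ i,
        fderiv ℝ (fun y => fderiv ℝ f y (Pi.single i 1)) (x ∘ ρ) (Pi.single i 1) := by
  have hd : ∀ y ∈ s, DifferentiableAt ℝ f y := fun y hy =>
    (hf.contDiffAt (hs.mem_nhds hy)).differentiableAt (by norm_num)
  have hd' : ∀ y ∈ s, ∀ i : ι,
      DifferentiableAt ℝ (fun z => fderiv ℝ f z (Pi.single i 1)) y := fun y hy i =>
    (((hf.contDiffAt (hs.mem_nhds hy)).fderiv_right (m := 1) (by norm_num)).differentiableAt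
      (by norm_num)).clm_apply (differentiableAt_const _)
  have key : ∀ i : ι, fderiv ℝ (fun y =>
      fderiv ℝ (fun z : ι → ℝ => ∑ ρ : Equiv.Perm ι, f (z ∘ ρ)) y (Pi.single i 1)) x
        (Pi.single i 1) =
      ∑ ρ : Equiv.Perm ι, fderiv ℝ (fun y => fderiv ℝ f y (Pi.single (ρ.symm i) 1)) (x ∘ ρ)
        (Pi.single (ρ.symm i) 1) := by
    intro i
    have hev : (fun y => fderiv ℝ (fun z : ι → ℝ => ∑ ρ : Equiv.Perm ι, f (z ∘ ρ)) y
        (Pi.single i 1)) =ᶠ[nhds x] fun y => ∑ ρ : Equiv.Perm ι,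
          (fun w => fderiv ℝ f w (Pi.single (ρ.symm i) 1)) (y ∘ ρ) := by
      filter_upwards [hs.mem_nhds hx] with y hy
      exact fderiv_sum_comp_perm_single (fun ρ => hd _ (hperm y hy ρ)) i
    rw [hev.fderiv_eq, fderiv_fun_sum fun ρ _ => (hd' _ (hperm x hx ρ) _).comp_perm,
      _root_.sum_apply]
    exact Finset.sum_congr rfl fun ρ _ =>
    fderiv_comp_perm_single (fun y => fderiv ℝ f y (Pi.single (ρ.symm i) 1)) ρ i x
  simp only [key]
  rw [Finset.sum_comm]
  exact Finset.sum_congr rfl fun ρ _ => Equiv.sum_comp ρ.symm fun j =>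
    fderiv ℝ (fun y => fderiv ℝ f y (Pi.single j 1)) (x ∘ ρ) (Pi.single j 1)

/-- A sum over ordered pairs of distinct indices is invariant under relabelling. -/
theorem sum_sum_erase_comp_perm (ρ : Equiv.Perm ι) (g : ι → ι → ℝ) :
    ∑ i, ∑ j ∈ Finset.univ.erase i, g (ρ i) (ρ j) =
      ∑ i, ∑ j ∈ Finset.univ.erase i, g i j := by
  rw [← Equiv.sum_comp ρ fun i => ∑ j ∈ Finset.univ.erase i, g i j]
  refine Finset.sum_congr rfl fun i _ => Finset.sum_equiv ρ ?_ fun _ _ => rfl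
  simp

/-- The drift term of the symmetrization of a function. -/
theorem drift_sum_comp_perm {f : (ι → ℝ) → ℝ} {x : ι → ℝ}
    (hf : ∀ ρ : Equiv.Perm ι, DifferentiableAt ℝ f (x ∘ ρ)) :
    ∑ i, ∑ j ∈ Finset.univ.erase i, (x i - x j)⁻¹ *
        fderiv ℝ (fun z : ι → ℝ => ∑ ρ : Equiv.Perm ι, f (z ∘ ρ)) x (Pi.single i 1) =
      ∑ ρ : Equiv.Perm ι, ∑ i, ∑ j ∈ Finset.univ.erase i,
        ((x ∘ ρ) i - (x ∘ ρ) j)⁻¹ * fderiv ℝ f (x ∘ ρ) (Pi.single i 1) := by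
  have hρ : ∀ ρ : Equiv.Perm ι, ∑ i, ∑ j ∈ Finset.univ.erase i,
        ((x ∘ ρ) i - (x ∘ ρ) j)⁻¹ * fderiv ℝ f (x ∘ ρ) (Pi.single i 1) =
      ∑ i, ∑ j ∈ Finset.univ.erase i,
        (x i - x j)⁻¹ * fderiv ℝ f (x ∘ ρ) (Pi.single (ρ.symm i) 1) := by
    intro ρ
    rw [← sum_sum_erase_comp_perm ρ fun i j =>
      (x i - x j)⁻¹ * fderiv ℝ f (x ∘ ρ) (Pi.single (ρ.symm i) 1)]
    simp only [Function.comp_apply, Equiv.symm_apply_apply]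
  simp only [hρ, fderiv_sum_comp_perm_single hf, Finset.mul_sum]
  rw [Finset.sum_comm]
  exact Finset.sum_congr rfl fun i _ => Finset.sum_comm

/-- The reflection term of the Dunkl operator vanishes after symmetrization. -/
theorem sum_perm_reflection_eq_zero (f : (ι → ℝ) → ℝ) (x : ι → ℝ) :
    ∑ ρ : Equiv.Perm ι, ∑ i, ∑ j ∈ Finset.univ.erase i,
      (f (x ∘ ρ) - f ((x ∘ ρ) ∘ Equiv.swap i j)) / ((x ∘ ρ) i - (x ∘ ρ) j) ^ 2 = 0 := by
  have hρ : ∀ ρ : Equiv.Perm ι, ∑ i, ∑ j ∈ Finset.univ.erase i,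
        (f (x ∘ ρ) - f ((x ∘ ρ) ∘ Equiv.swap i j)) / ((x ∘ ρ) i - (x ∘ ρ) j) ^ 2 =
      ∑ i, ∑ j ∈ Finset.univ.erase i,
        (f (x ∘ ρ) - f (x ∘ (Equiv.swap i j * ρ : Equiv.Perm ι))) / (x i - x j) ^ 2 := by
    intro ρ
    rw [← sum_sum_erase_comp_perm ρ fun i j =>
      (f (x ∘ ρ) - f (x ∘ (Equiv.swap i j * ρ : Equiv.Perm ι))) / (x i - x j) ^ 2]
    refine Finset.sum_congr rfl fun i _ => Finset.sum_congr rfl fun j _ => ?_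
    rw [← Equiv.mul_swap_eq_swap_mul]
    rfl
  simp only [hρ]
  rw [Finset.sum_comm]
  refine Finset.sum_eq_zero fun i _ => ?_
  rw [Finset.sum_comm]
  refine Finset.sum_eq_zero fun j _ => ?_
  have hswap := Equiv.sum_comp (Equiv.mulLeft (Equiv.swap i j))
    fun ρ : Equiv.Perm ι => f (x ∘ ρ)
  simp only [Equiv.coe_mulLeft] at hswap
  rw [← Finset.sum_div, Finset.sum_sub_distrib, hswap, sub_self, zero_div]

end PermutedCoordinates

/-- If `u` (once continuously differentiable in `t`, twice continuously
differentiable in `x`) satisfies the type-A Dunkl backward equation on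
`(0,∞) × Ω`, where `Ω` is the set of points with pairwise distinct
coordinates, then the symmetrization `U(t,x) = ∑_{ρ∈S_N} u(t,ρx)` satisfies
Dyson's backward equation on `(0,∞) × Ω`. -/
theorem stmt_0 (N : ℕ) (hN : 2 ≤ N) (k : ℝ) (hk : 0 ≤ k)
    (Ω : Set (Fin N → ℝ))
    (hΩ : Ω = {x : Fin N → ℝ | ∀ i j : Fin N, i ≠ j → x i ≠ x j})
    (u : ℝ → (Fin N → ℝ) → ℝ)
    (hreg_t : ∀ x ∈ Ω, ContDiffOn ℝ 1 (fun t => u t x) (Ioi (0 : ℝ)))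
    (hreg_x : ∀ t ∈ Ioi (0 : ℝ), ContDiffOn ℝ 2 (fun x => u t x) Ω)
    (hPDE : ∀ t ∈ Ioi (0 : ℝ), ∀ x ∈ Ω,
      deriv (fun s => u s x) t
        = (1 / 2) * ∑ i, fderiv ℝ
              (fun y => fderiv ℝ (fun z => u t z) y (Pi.single i 1)) x (Pi.single i 1)
          + k * ∑ i, ∑ j ∈ Finset.univ.erase i,
              (x i - x j)⁻¹ * fderiv ℝ (fun z => u t z) x (Pi.single i 1)
          - (k / 2) * ∑ i, ∑ j ∈ Finset.univ.erase i,
              (u t x - u t (x ∘ Equiv.swap i j)) / (x i - x j) ^ 2) :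
    ∀ t ∈ Ioi (0 : ℝ), ∀ x ∈ Ω,
      deriv (fun s => ∑ ρ : Equiv.Perm (Fin N), u s (x ∘ ρ)) t
        = (1 / 2) * ∑ i, fderiv ℝ
              (fun y => fderiv ℝ (fun z => ∑ ρ : Equiv.Perm (Fin N), u t (z ∘ ρ))
                y (Pi.single i 1)) x (Pi.single i 1)
          + k * ∑ i, ∑ j ∈ Finset.univ.erase i,
              (x i - x j)⁻¹ * fderiv ℝ
                (fun z => ∑ ρ : Equiv.Perm (Fin N), u t (z ∘ ρ)) x (Pi.single i 1) := by
  intro t ht x hx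
  have hs : IsOpen Ω := hΩ ▸ isOpen_setOf_pairwise_ne
  have hperm : ∀ y ∈ Ω, ∀ ρ : Equiv.Perm (Fin N), y ∘ ρ ∈ Ω := by
    subst hΩ
    exact fun y hy ρ i j hij => hy _ _ (ρ.injective.ne hij)
  have hd : ∀ ρ : Equiv.Perm (Fin N), DifferentiableAt ℝ (fun z => u t z) (x ∘ ρ) := fun ρ =>
    ((hreg_x t ht).contDiffAt (hs.mem_nhds (hperm x hx ρ))).differentiableAt (by norm_num)
  have hdt : ∀ ρ : Equiv.Perm (Fin N), DifferentiableAt ℝ (fun s => u s (x ∘ ρ)) t := fun ρ =>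
    ((hreg_t _ (hperm x hx ρ)).contDiffAt (Ioi_mem_nhds ht)).differentiableAt (by norm_num)
  rw [deriv_fun_sum fun ρ _ => hdt ρ, laplacian_sum_comp_perm hs hperm (hreg_x t ht) hx,
    drift_sum_comp_perm hd, Finset.sum_congr rfl fun ρ _ => hPDE t ht _ (hperm x hx ρ),
    Finset.sum_sub_distrib, Finset.sum_add_distrib, ← Finset.mul_sum, ← Finset.mul_sum,
    ← Finset.mul_sum, sum_perm_reflection_eq_zero (fun z => u t z) x, mul_zero, sub_zero]
end

section
/- Let N ≥ 1 and let z ∈ ℝ^N have pairwise distinct coordinates. If z_i = ∑_{j≠i} 1/(z_i − z_j) holds for every i = 1,…,N, then the monic polynomial ∏_{i=1}^N (X − z_i) equals 2^{−N} H_N(X); in particular z_1,…,z_N are exactly the N roots of the physicist's Hermite polynomial H_N. -/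
/-- Physicist's Hermite polynomials: `H 0 = 1`, `H 1 = 2x`,
`H (n+2) = 2x * H (n+1) - 2(n+1) * H n`. -/
noncomputable def physHermite : ℕ → Polynomial ℝ
  | 0 => 1
  | 1 => Polynomial.C 2 * Polynomial.X
  | (n + 2) => Polynomial.C 2 * Polynomial.X * physHermite (n + 1)
      - Polynomial.C (2 * ((n : ℝ) + 1)) * physHermite n

open Polynomial in
/-- The lowering relation `H_{n+1}' = 2(n+1) H_n`. -/
theorem derivative_physHermite_succ : ∀ n : ℕ,
    derivative (physHermite (n + 1)) = C (2 * ((n : ℝ) + 1)) * physHermite n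
  | 0 => by simp [physHermite]
  | 1 => by
    simp only [physHermite, derivative_sub, derivative_mul, derivative_C, derivative_X,
      derivative_one]
    norm_num
    simp only [map_ofNat]
    ring
  | n + 2 => by
    rw [physHermite, derivative_sub, derivative_mul, derivative_mul, derivative_mul,
      derivative_physHermite_succ (n + 1), derivative_physHermite_succ n, physHermite.eq_3 n]
    simp only [derivative_C, derivative_X]
    push_cast
    simp only [map_mul, map_add, map_natCast, map_ofNat, map_one]
    ring

open Polynomial in
/-- Hermite's differential equation `H_n'' - 2x H_n' + 2n H_n = 0`. -/
theorem physHermite_differential_equation : ∀ n : ℕ,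
    derivative (derivative (physHermite n)) - C 2 * X * derivative (physHermite n)
      + C (2 * (n : ℝ)) * physHermite n = 0
  | 0 => by simp [physHermite]
  | 1 => by
    simp only [physHermite, derivative_mul, derivative_C, derivative_X]
    simp
    ring
  | n + 2 => by
    rw [derivative_physHermite_succ (n + 1), derivative_C_mul, derivative_physHermite_succ n,
      physHermite.eq_3 n]
    push_cast
    simp only [map_mul, map_add, map_natCast, map_ofNat, map_one]
    ring

theorem physHermite_natDegree_le : ∀ n : ℕ, (physHermite n).natDegree ≤ n
  | 0 => by simp [physHermite]
  | 1 => by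
    rw [physHermite]
    compute_degree
  | n + 2 => by
    have h₁ := physHermite_natDegree_le (n + 1)
    have h₀ := physHermite_natDegree_le n
    rw [physHermite]
    refine (Polynomial.natDegree_sub_le _ _).trans (max_le ?_ ?_)
    · rw [mul_assoc]
      refine (Polynomial.natDegree_C_mul_le _ _).trans (Polynomial.natDegree_mul_le.trans ?_)
      rw [Polynomial.natDegree_X]
      omega
    · exact (Polynomial.natDegree_C_mul_le _ _).trans (by omega)

theorem physHermite_coeff_self : ∀ n : ℕ, (physHermite n).coeff n = 2 ^ n
  | 0 => by simp [physHermite]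
  | 1 => by simp [physHermite]
  | n + 2 => by
    have h₀ : (physHermite n).coeff (n + 2) = 0 :=
      Polynomial.coeff_eq_zero_of_natDegree_lt (by have := physHermite_natDegree_le n; omega)
    rw [physHermite, Polynomial.coeff_sub, mul_assoc, Polynomial.coeff_C_mul,
      Polynomial.coeff_X_mul, physHermite_coeff_self (n + 1), Polynomial.coeff_C_mul, h₀]
    ring

open Polynomial in
theorem coeff_hermite_operator (c : ℝ) (d : ℝ[X]) (k : ℕ) :
    (derivative (derivative d) - C 2 * X * derivative d + C c * d).coeff k
      = d.coeff (k + 2) * (k + 2) * (k + 1) + (c - 2 * k) * d.coeff k := by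
  have hX : (X * derivative d).coeff k = k * d.coeff k := by
    cases k with
    | zero => simp
    | succ k => rw [coeff_X_mul, coeff_derivative]; push_cast; ring
  rw [coeff_add, coeff_sub, mul_assoc, coeff_C_mul, coeff_C_mul, hX, coeff_derivative,
    coeff_derivative]
  push_cast
  ring

open Polynomial in
/-- Hermite's equation of index `N` has no nonzero polynomial solution of degree less than `N`. -/
theorem eq_zero_of_hermite_differential_equation {N : ℕ} {d : ℝ[X]} (hd : d.degree < N)
    (h : derivative (derivative d) - C 2 * X * derivative d + C (2 * (N : ℝ)) * d = 0) :
    d = 0 := by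
  by_contra hne
  have hlt : d.natDegree < N := (natDegree_lt_iff_degree_lt hne).2 hd
  have hc := coeff_hermite_operator (2 * (N : ℝ)) d d.natDegree
  rw [h, coeff_zero, coeff_eq_zero_of_natDegree_lt (p := d) (n := d.natDegree + 2) (by omega)] at hc
  have hlt' : (d.natDegree : ℝ) < N := by exact_mod_cast hlt
  have hlead : d.coeff d.natDegree ≠ 0 := leadingCoeff_ne_zero.2 hne
  have : (2 * (N : ℝ) - 2 * d.natDegree) * d.coeff d.natDegree ≠ 0 :=
    mul_ne_zero (by linarith) hlead
  apply this
  linarith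

open Polynomial in
theorem eval_derivative_prod_X_sub_C {ι : Type*} [DecidableEq ι] (s : Finset ι) (z : ι → ℝ) (x : ℝ)
    (hx : ∀ i ∈ s, x ≠ z i) :
    (derivative (∏ i ∈ s, (X - C (z i)))).eval x
      = (∏ i ∈ s, (X - C (z i))).eval x * ∑ i ∈ s, 1 / (x - z i) := by
  rw [derivative_prod_finset, eval_finsetSum, Finset.mul_sum]
  refine Finset.sum_congr rfl fun i hi => ?_
  have hne : x - z i ≠ 0 := sub_ne_zero.2 (hx i hi)
  rw [← Finset.mul_prod_erase s _ hi]
  simp only [derivative_X_sub_C, mul_one, eval_mul, eval_sub, eval_X, eval_C]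
  field_simp

open Polynomial in
/-- The node polynomial of a solution of the Stieltjes equations solves Hermite's equation at
the nodes. -/
theorem eval_hermite_operator_prod_X_sub_C {ι : Type*} [Fintype ι] [DecidableEq ι] {z : ι → ℝ}
    (hz : Function.Injective z) (i : ι)
    (hi : z i = ∑ j ∈ Finset.univ.erase i, 1 / (z i - z j)) (c : ℝ) :
    (derivative (derivative (∏ i, (X - C (z i)))) - C 2 * X * derivative (∏ i, (X - C (z i)))
      + C c * ∏ i, (X - C (z i))).eval (z i) = 0 := by
  have hq := eval_derivative_prod_X_sub_C (Finset.univ.erase i) z (z i)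
    fun j hj h => Finset.ne_of_mem_erase hj (hz h).symm
  rw [← hi] at hq
  rw [← Finset.mul_prod_erase Finset.univ _ (Finset.mem_univ i)]
  simp only [derivative_mul, derivative_X_sub_C, derivative_add, derivative_one, eval_add,
    eval_sub, eval_mul, eval_C, eval_X, eval_one, eval_zero, hq]
  ring

open Polynomial in
theorem prod_X_sub_C_hermite_differential_equation {N : ℕ} {z : Fin N → ℝ}
    (hz : Function.Injective z)
    (heq : ∀ i, z i = ∑ j ∈ Finset.univ.erase i, 1 / (z i - z j)) :
    derivative (derivative (∏ i, (X - C (z i)))) - C 2 * X * derivative (∏ i, (X - C (z i)))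
      + C (2 * (N : ℝ)) * ∏ i, (X - C (z i)) = 0 := by
  refine eq_zero_of_degree_lt_of_eval_index_eq_zero (s := Finset.univ) (v := z) hz.injOn ?_
    fun i _ => eval_hermite_operator_prod_X_sub_C hz i (heq i) _
  have hdeg : (∏ i, (X - C (z i))).natDegree = N := by
    simp [natDegree_prod_of_monic _ _ fun i _ => monic_X_sub_C (z i)]
  rw [Finset.card_fin, degree_lt_iff_coeff_zero]
  intro k hk
  rw [coeff_hermite_operator, coeff_eq_zero_of_natDegree_lt (n := k + 2) (by omega)]
  rcases hk.eq_or_lt with rfl | hk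
  · ring
  · rw [coeff_eq_zero_of_natDegree_lt (n := k) (by omega)]
    ring

/-- If `z ∈ ℝ^N` has pairwise distinct coordinates and satisfies
`z_i = ∑_{j≠i} 1/(z_i − z_j)` for every `i`, then `∏ (X − z_i) = 2^{−N} H_N`,
so the `z_i` are exactly the roots of the physicist's Hermite polynomial `H_N`. -/
theorem stmt_2 (N : ℕ) (hN : 1 ≤ N) (z : Fin N → ℝ) (hz : Function.Injective z)
    (heq : ∀ i, z i = ∑ j ∈ Finset.univ.erase i, 1 / (z i - z j)) :
    Polynomial.C ((2 : ℝ) ^ N) * ∏ i : Fin N, (Polynomial.X - Polynomial.C (z i))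
      = physHermite N
    ∧ (∀ x : ℝ, (physHermite N).eval x = 0 ↔ ∃ i, x = z i) := by
  have hprod : Polynomial.C ((2 : ℝ) ^ N) * ∏ i : Fin N, (Polynomial.X - Polynomial.C (z i))
      = physHermite N := by
    have hmonic := Polynomial.monic_prod_of_monic Finset.univ
      (fun i => Polynomial.X - Polynomial.C (z i)) fun i _ => Polynomial.monic_X_sub_C (z i)
    have hdeg : (∏ i : Fin N, (Polynomial.X - Polynomial.C (z i))).natDegree = N := by
      simp [Polynomial.natDegree_prod_of_monic _ _ fun i _ => Polynomial.monic_X_sub_C (z i)]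
    have hode := prod_X_sub_C_hermite_differential_equation hz heq
    have hH := physHermite_differential_equation N
    generalize ∏ i : Fin N, (Polynomial.X - Polynomial.C (z i)) = p at *
    refine sub_eq_zero.1 (eq_zero_of_hermite_differential_equation (N := N) ?_ ?_)
    · rw [Polynomial.degree_lt_iff_coeff_zero]
      intro k hk
      rw [Polynomial.coeff_sub, Polynomial.coeff_C_mul]
      rcases hk.eq_or_lt with rfl | hk
      · have hlead : p.coeff N = 1 := by simpa [hdeg] using hmonic.coeff_natDegree
        rw [hlead, physHermite_coeff_self]
        ring
      · rw [Polynomial.coeff_eq_zero_of_natDegree_lt (hdeg.trans_lt hk),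
          Polynomial.coeff_eq_zero_of_natDegree_lt ((physHermite_natDegree_le N).trans_lt hk)]
        ring
    · simp only [Polynomial.derivative_sub, Polynomial.derivative_C_mul]
      linear_combination Polynomial.C ((2 : ℝ) ^ N) * hode - hH
  refine ⟨hprod, fun x => ?_⟩
  rw [← hprod]
  simp [Polynomial.eval_prod, Finset.prod_eq_zero_iff, sub_eq_zero]
end

section
/- Let N ≥ 1, t > 0, and let v ∈ ℝ^N have pairwise distinct coordinates. Define the N×N matrix H by H_{ii} = −∑_{l≠i} 2/(v_i − v_l)² − 1/t and H_{ij} = 2/(v_i − v_j)² for i ≠ j (these are the second partial derivatives ∂²F_N/∂v_j∂v_i of v ↦ F_N(v,t)). Then for every u ∈ ℝ^N one has ∑_{i,j} u_i H_{ij} u_j = −(1/t)∑_{i=1}^N u_i² − 2∑_{1≤i<j≤N}(u_i − u_j)²/(v_i − v_j)², and in particular ∑_{i,j} u_i H_{ij} u_j < 0 whenever u ≠ 0, so H is negative definite. -/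
/-- A double sum of a symmetric function vanishing on the diagonal is twice the sum over `i < j`. -/
theorem sum_sum_eq_two_mul_sum_sum_Ioi {ι : Type*} [Fintype ι] [LinearOrder ι]
    [LocallyFiniteOrderTop ι] [LocallyFiniteOrderBot ι] (f : ι → ι → ℝ)
    (hsymm : ∀ i j, f i j = f j i) (hdiag : ∀ i, f i i = 0) :
    ∑ i, ∑ j, f i j = 2 * ∑ i, ∑ j ∈ Finset.Ioi i, f i j := by
  have h := Finset.sum_sum_Ioi_add_eq_sum_sum_off_diag f
  calc ∑ i, ∑ j, f i j = ∑ i, ∑ j ∈ {i}ᶜ, f j i := by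
        refine Finset.sum_congr rfl fun i _ => ?_
        rw [Fintype.sum_eq_add_sum_compl i, hdiag, zero_add]
        exact Finset.sum_congr rfl fun j _ => hsymm i j
    _ = 2 * ∑ i, ∑ j ∈ Finset.Ioi i, f i j := by
        rw [← h]
        simp only [Finset.mul_sum]
        refine Finset.sum_congr rfl fun i _ => Finset.sum_congr rfl fun j _ => ?_
        rw [hsymm j i, two_mul]

/-- The quadratic form of a symmetric weighted graph Laplacian as a sum of weighted squares. -/
theorem sum_sum_mul_sub_sum_mul_sq {ι : Type*} [Fintype ι] (w : ι → ι → ℝ)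
    (hsymm : ∀ i j, w i j = w j i) (u : ι → ℝ) :
    ∑ i, ∑ j, u i * w i j * u j - ∑ i, (∑ j, w i j) * u i ^ 2
      = -(1 / 2) * ∑ i, ∑ j, w i j * (u i - u j) ^ 2 := by
  have h : ∑ i, ∑ j, w i j * u j ^ 2 = ∑ i, ∑ j, w i j * u i ^ 2 := by
    rw [Finset.sum_comm]
    exact Finset.sum_congr rfl fun i _ => Finset.sum_congr rfl fun j _ => by rw [hsymm]
  have hexp : ∑ i, ∑ j, w i j * (u i - u j) ^ 2
      = ∑ i, ∑ j, w i j * u i ^ 2 + ∑ i, ∑ j, w i j * u j ^ 2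
        - 2 * ∑ i, ∑ j, u i * w i j * u j := by
    simp only [Finset.mul_sum, ← Finset.sum_add_distrib, ← Finset.sum_sub_distrib]
    exact Finset.sum_congr rfl fun i _ => Finset.sum_congr rfl fun j _ => by ring
  simp only [Finset.sum_mul]
  rw [hexp, h]
  ring

/-- The Hessian of `v ↦ F_N(v,t)` is negative definite: its quadratic form equals
`−(1/t)∑ u_i² − 2∑_{i<j}(u_i − u_j)²/(v_i − v_j)²`, which is negative for `u ≠ 0`. -/
theorem stmt_4 (N : ℕ) (hN : 1 ≤ N) (t : ℝ) (ht : 0 < t)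
    (v : Fin N → ℝ) (hv : Function.Injective v)
    (H : Fin N → Fin N → ℝ)
    (hH : ∀ i j, H i j =
      if i = j then -(∑ l ∈ Finset.univ.erase i, 2 / (v i - v l) ^ 2) - 1 / t
      else 2 / (v i - v j) ^ 2) :
    ∀ u : Fin N → ℝ,
      (∑ i, ∑ j, u i * H i j * u j
          = -(1 / t) * ∑ i, u i ^ 2
            - 2 * ∑ i, ∑ j ∈ Finset.Ioi i, (u i - u j) ^ 2 / (v i - v j) ^ 2)
      ∧ (u ≠ 0 → ∑ i, ∑ j, u i * H i j * u j < 0) := by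
  intro u
  let w : Fin N → Fin N → ℝ := fun i j => 2 / (v i - v j) ^ 2
  have hw : ∀ i j, w i j = w j i := fun i j => by
    simp only [w]
    rw [← neg_sub, neg_sq]
  have hw0 : ∀ i, w i i = 0 := fun i => by simp [w]
  have hHw : ∀ i j, H i j = w i j - if i = j then ∑ l, w i l + 1 / t else 0 := by
    intro i j
    rw [hH]
    split_ifs with hij
    · subst hij
      rw [hw0, ← Finset.add_sum_erase _ _ (Finset.mem_univ i), hw0]
      ring
    · rw [sub_zero]
  have hform : ∑ i, ∑ j, u i * H i j * u j
      = -(1 / t) * ∑ i, u i ^ 2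
        - 2 * ∑ i, ∑ j ∈ Finset.Ioi i, (u i - u j) ^ 2 / (v i - v j) ^ 2 := by
    have hsplit : ∑ i, ∑ j, u i * H i j * u j
        = (∑ i, ∑ j, u i * w i j * u j - ∑ i, (∑ j, w i j) * u i ^ 2)
          - 1 / t * ∑ i, u i ^ 2 := by
      rw [Finset.mul_sum, ← Finset.sum_sub_distrib, ← Finset.sum_sub_distrib]
      refine Finset.sum_congr rfl fun i _ => ?_
      simp only [hHw, mul_sub, sub_mul, Finset.sum_sub_distrib, mul_ite, ite_mul, mul_zero,
        zero_mul, Finset.sum_ite_eq, Finset.mem_univ, if_true]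
      ring
    have hpairs := sum_sum_eq_two_mul_sum_sum_Ioi (fun i j => w i j * (u i - u j) ^ 2)
      (fun i j => by rw [hw i j, ← neg_sub, neg_sq]) (fun i => by simp)
    have hscale : ∑ i, ∑ j ∈ Finset.Ioi i, w i j * (u i - u j) ^ 2
        = 2 * ∑ i, ∑ j ∈ Finset.Ioi i, (u i - u j) ^ 2 / (v i - v j) ^ 2 := by
      simp only [Finset.mul_sum]
      refine Finset.sum_congr rfl fun i _ => Finset.sum_congr rfl fun j _ => ?_
      simp only [w]
      ring
    rw [hsplit, sum_sum_mul_sub_sum_mul_sq w hw, hpairs, hscale]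
    ring
  refine ⟨hform, fun hu => ?_⟩
  rw [hform]
  obtain ⟨k, hk⟩ := Function.ne_iff.mp hu
  have hpos : 0 < ∑ i, u i ^ 2 :=
    Finset.sum_pos' (fun i _ => sq_nonneg _) ⟨k, Finset.mem_univ k, sq_pos_of_ne_zero hk⟩
  have hnonneg : 0 ≤ ∑ i, ∑ j ∈ Finset.Ioi i, (u i - u j) ^ 2 / (v i - v j) ^ 2 := by positivity
  have := mul_pos (one_div_pos.mpr ht) hpos
  linarith
end

section
/- Let N ≥ 1 and let z : Fin N → ℝ be strictly increasing with H_N(z_i) = 0 for every i (so z enumerates the N roots of the physicist's Hermite polynomial H_N). Then ∏_{i=1}^N H_{N−1}(z_i) = (−2)^{N(N−1)/2} ∏_{j=1}^{N−1} j^j. -/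
open Polynomial in
theorem natDegree_physHermite_le_and_coeff (n : ℕ) :
    (physHermite n).natDegree ≤ n ∧ (physHermite n).coeff n = 2 ^ n := by
  induction n using Nat.twoStepInduction with
  | zero => simp [physHermite]
  | one => simp [physHermite]
  | more n ih₀ ih₁ =>
    constructor
    · rw [physHermite, mul_assoc]
      refine (natDegree_sub_le _ _).trans (max_le ?_ ?_)
      · refine (natDegree_C_mul_le _ _).trans (natDegree_mul_le.trans ?_)
        rw [natDegree_X]
        lia
      · exact (natDegree_C_mul_le _ _).trans (by lia)
    · rw [physHermite, coeff_sub, mul_assoc, coeff_C_mul, coeff_X_mul, coeff_C_mul, ih₁.2,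
        coeff_eq_zero_of_natDegree_lt (by lia : (physHermite n).natDegree < n + 2)]
      ring

theorem natDegree_physHermite (n : ℕ) : (physHermite n).natDegree = n :=
  Polynomial.natDegree_eq_of_le_of_coeff_ne_zero (natDegree_physHermite_le_and_coeff n).1
    (by rw [(natDegree_physHermite_le_and_coeff n).2]; positivity)

theorem coeff_physHermite_self (n : ℕ) : (physHermite n).coeff n = 2 ^ n :=
  (natDegree_physHermite_le_and_coeff n).2

theorem leadingCoeff_physHermite (n : ℕ) : (physHermite n).leadingCoeff = 2 ^ n := by
  rw [Polynomial.leadingCoeff, natDegree_physHermite, coeff_physHermite_self]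

open Polynomial in
theorem resultant_physHermite_succ (n : ℕ) :
    (physHermite (n + 2)).resultant (physHermite (n + 1)) (n + 2) (n + 1)
      = (-2 * ((n : ℝ) + 1)) ^ (n + 1) * 4 ^ (n + 1)
        * (physHermite (n + 1)).resultant (physHermite n) (n + 1) n := by
  have hrec : physHermite (n + 2) = C (-2 * ((n : ℝ) + 1)) * physHermite n
      + physHermite (n + 1) * (C 2 * X) := by
    rw [physHermite, neg_mul, C_neg]
    ring
  have hdeg : (C (2 : ℝ) * X).natDegree + (n + 1) ≤ n + 2 := by
    have := natDegree_C_mul_X (2 : ℝ) two_ne_zero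
    lia
  rw [hrec, resultant_add_mul_left _ _ _ _ _ hdeg (natDegree_physHermite _).le,
    resultant_C_mul_left, resultant_add_left_deg _ _ _ _ _ (natDegree_physHermite n).le,
    coeff_physHermite_self, resultant_comm (physHermite n), (Nat.even_mul_succ_self n).neg_one_pow,
    ((even_two).mul_left (n + 1)).neg_one_pow, ← pow_mul, mul_comm (n + 1) 2, pow_mul]
  norm_num
  ring

theorem resultant_physHermite (n : ℕ) :
    (physHermite (n + 1)).resultant (physHermite n) (n + 1) n
      = (2 ^ (n + 1)) ^ n * ((-2 : ℝ) ^ ((n + 1) * n / 2) * ∏ j ∈ Finset.Icc 1 n, (j : ℝ) ^ j) := by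
  induction n with
  | zero => simp [physHermite]
  | succ n ih =>
    have htri : (n + 1 + 1) * (n + 1) / 2 = (n + 1) * n / 2 + (n + 1) := by
      rw [show (n + 1 + 1) * (n + 1) = (n + 1) * n + (n + 1) * 2 by ring,
        Nat.add_mul_div_right _ _ two_pos]
    have hpow : ((2 : ℝ) ^ (n + 1 + 1)) ^ (n + 1) = 4 ^ (n + 1) * (2 ^ (n + 1)) ^ n := by
      rw [show (4 : ℝ) = 2 ^ 2 by norm_num]
      simp only [← pow_mul, ← pow_add]
      ring_nf
    rw [resultant_physHermite_succ, ih, htri, hpow, Finset.prod_Icc_succ_top (by lia),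
      mul_pow, pow_add]
    push_cast
    ring

theorem Polynomial.roots_eq_map_of_injective {R ι : Type*} [CommRing R] [IsDomain R] [Fintype ι]
    {p : Polynomial R} (hp : p ≠ 0) {z : ι → R} (hz : Function.Injective z)
    (hroot : ∀ i, p.eval (z i) = 0) (hcard : p.natDegree ≤ Fintype.card ι) :
    p.roots = Finset.univ.val.map z := by
  refine (Multiset.eq_of_le_of_card_le ?_ ?_).symm
  · refine (Multiset.le_iff_subset (Finset.univ.nodup.map hz)).2 fun x hx ↦ ?_
    obtain ⟨i, -, rfl⟩ := Multiset.mem_map.1 hx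
    exact (mem_roots hp).2 (hroot i)
  · simpa using p.card_roots'.trans hcard

/-- If `z` enumerates the `N` roots of `H_N` in increasing order, then
`∏_{i=1}^N H_{N−1}(z_i) = (−2)^{N(N−1)/2} ∏_{j=1}^{N−1} j^j`. -/
theorem stmt_9 (N : ℕ) (hN : 1 ≤ N) (z : Fin N → ℝ) (hz : StrictMono z)
    (hroot : ∀ i, (physHermite N).eval (z i) = 0) :
    ∏ i : Fin N, (physHermite (N - 1)).eval (z i)
      = (-2 : ℝ) ^ (N * (N - 1) / 2) * ∏ j ∈ Finset.Icc 1 (N - 1), (j : ℝ) ^ j := by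
  obtain ⟨n, rfl⟩ := Nat.exists_eq_add_of_le' hN
  rw [Nat.add_sub_cancel]
  have hne : physHermite (n + 1) ≠ 0 := by
    rw [← Polynomial.leadingCoeff_ne_zero, leadingCoeff_physHermite]
    positivity
  have hroots := Polynomial.roots_eq_map_of_injective hne hz.injective hroot
    (by rw [natDegree_physHermite, Fintype.card_fin])
  have hsplits : (physHermite (n + 1)).Splits := by
    rw [Polynomial.splits_iff_card_roots, hroots, natDegree_physHermite]
    simp
  have hres := Polynomial.resultant_eq_prod_eval _ (physHermite n) n
    (natDegree_physHermite n).le hsplits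
  rw [natDegree_physHermite, leadingCoeff_physHermite, resultant_physHermite, hroots,
    Multiset.map_map] at hres
  exact (mul_left_cancel₀ (by positivity) hres).symm
end

section
/- Let N ≥ 2. Let z : Fin N → ℝ be strictly increasing with H_N(z_i) = 0 for every i, and let w : Fin (N−1) → ℝ be strictly increasing with H_{N−1}(w_j) = 0 for every j (so z and w enumerate the roots of H_N and H_{N−1} respectively). Then ∏_{i=1}^N H_{N−1}(z_i) = ∏_{j=1}^{N−1} H_N(w_j). -/
open Polynomial in
theorem Polynomial.eq_C_mul_prod_X_sub_C_of_injective {R : Type*} [CommRing R] [IsDomain R]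
    {n : ℕ} {p : R[X]} (hp : p.natDegree ≤ n) {z : Fin n → R} (hz : Function.Injective z)
    (hroot : ∀ i, p.eval (z i) = 0) :
    p = C (p.coeff n) * ∏ i, (X - C (z i)) := by
  have h_deg : (∏ i, (X - C (z i))).natDegree = n := by
    simp [natDegree_prod_of_monic _ _ fun i _ => monic_X_sub_C (z i)]
  have h_lead : (∏ i, (X - C (z i))).coeff n = 1 := by
    have h := monic_prod_of_monic Finset.univ _ fun i _ => monic_X_sub_C (z i)
    rwa [Monic, leadingCoeff, h_deg] at h
  refine eq_of_degree_sub_lt_of_eval_index_eq Finset.univ hz.injOn ?_ fun i _ => ?_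
  · rw [Finset.card_univ, Fintype.card_fin, degree_lt_iff_coeff_zero]
    intro m hm
    rcases hm.eq_or_lt with rfl | hm
    · simp [h_lead]
    · rw [coeff_sub, coeff_C_mul, coeff_eq_zero_of_natDegree_lt (hp.trans_lt hm),
        coeff_eq_zero_of_natDegree_lt (h_deg.trans_lt hm), mul_zero, sub_zero]
  · rw [hroot, eval_mul, eval_prod, Finset.prod_eq_zero (Finset.mem_univ i) (by simp), mul_zero]

theorem eval_physHermite_of_roots {n : ℕ} {z : Fin n → ℝ} (hz : Function.Injective z)
    (hroot : ∀ i, (physHermite n).eval (z i) = 0) (x : ℝ) :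
    (physHermite n).eval x = 2 ^ n * ∏ i, (x - z i) := by
  obtain ⟨hdeg, hcoeff⟩ := natDegree_physHermite_le_and_coeff n
  rw [Polynomial.eq_C_mul_prod_X_sub_C_of_injective hdeg hz hroot, hcoeff]
  simp [Polynomial.eval_prod]

/-- If `z` and `w` enumerate (in increasing order) the roots of `H_N` and `H_{N−1}`
respectively, then `∏_{i=1}^N H_{N−1}(z_i) = ∏_{j=1}^{N−1} H_N(w_j)`. -/
theorem stmt_10 (N : ℕ) (hN : 2 ≤ N)
    (z : Fin N → ℝ) (hz : StrictMono z)
    (hzroot : ∀ i, (physHermite N).eval (z i) = 0)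
    (w : Fin (N - 1) → ℝ) (hw : StrictMono w)
    (hwroot : ∀ j, (physHermite (N - 1)).eval (w j) = 0) :
    ∏ i : Fin N, (physHermite (N - 1)).eval (z i)
      = ∏ j : Fin (N - 1), (physHermite N).eval (w j) := by
  have h_even : Even ((N - 1) * N) := by
    obtain ⟨m, rfl⟩ := Nat.exists_eq_add_of_le' (show 1 ≤ N by lia)
    exact Nat.even_mul_succ_self m
  have h_swap : ∏ i, ∏ j, (z i - w j) = ∏ j, ∏ i, (w j - z i) := by
    calc ∏ i, ∏ j, (z i - w j) = ∏ i, ∏ j, (-1) * (w j - z i) := by simp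
      _ = ∏ j, ∏ i, (w j - z i) := by
        simp_rw [Finset.prod_mul_distrib, Finset.prod_const, Finset.card_univ, Fintype.card_fin]
        rw [← pow_mul, h_even.neg_one_pow, one_mul, Finset.prod_comm]
  simp_rw [eval_physHermite_of_roots hz.injective hzroot,
    eval_physHermite_of_roots hw.injective hwroot, Finset.prod_mul_distrib, Finset.prod_const,
    Finset.card_univ, Fintype.card_fin, h_swap, ← pow_mul, mul_comm]
end

section
/- Let N ≥ 1 and x, y ∈ ℝ^N. Then ∑_{ρ∈S_N} exp(∑_{j=1}^N x_{ρ(j)} y_j) = ∑_{μ} [M(μ,N)/(N!·∏_{j=1}^N μ_j!)] · (∑_{σ∈S_N} ∏_{j=1}^N x_j^{μ_{σ(j)}}) · (∑_{σ∈S_N} ∏_{j=1}^N y_j^{μ_{σ(j)}}), where the (absolutely convergent) sum on the right runs over all weakly decreasing vectors μ ∈ ℕ^N (i.e. μ_1 ≥ μ_2 ≥ … ≥ μ_N ≥ 0), and M(μ,N) denotes the number of distinct vectors of the form (μ_{σ(1)},…,μ_{σ(N)}) with σ ∈ S_N. -/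
open scoped BigOperators

/-- A product of finitely many convergent real series is the sum over all multi-indices. -/
theorem hasSum_pi_prod {n : ℕ} {β : Type*} {f : Fin n → β → ℝ} {a : Fin n → ℝ}
    (h : ∀ i, HasSum (f i) (a i)) :
    HasSum (fun ν : Fin n → β => ∏ i, f i (ν i)) (∏ i, a i) := by
  induction n with
  | zero =>
    simp
  | succ n ih =>
    have hs : HasSum (fun ν : Fin n → β => ∏ i, f i.succ (ν i)) (∏ i, a (Fin.succ i)) :=
      ih fun i => h i.succ
    generalize hg : (fun ν : Fin n → β => ∏ i, f i.succ (ν i)) = g at hs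
    have hp := (h 0).mul hs
      (summable_mul_of_summable_norm (h 0).summable.norm hs.summable.norm)
    subst hg
    rw [Fin.prod_univ_succ, ← (Fin.consEquiv fun _ => β).hasSum_iff]
    refine hp.congr_fun fun p => ?_
    simp [Fin.prod_univ_succ, Fin.consEquiv]

/-- Summing over the distinct rearrangements of `μ` is averaging over all permutations. -/
theorem card_image_comp_perm_mul_sum {ι α : Type*} [Fintype ι] [DecidableEq ι] [DecidableEq α]
    (μ : ι → α) (f : (ι → α) → ℝ) :
    ((Finset.univ.image fun σ : Equiv.Perm ι => μ ∘ σ).card : ℝ)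
        * ∑ σ : Equiv.Perm ι, f (μ ∘ σ)
      = ((Fintype.card ι).factorial : ℝ)
        * ∑ ν ∈ Finset.univ.image (fun σ : Equiv.Perm ι => μ ∘ σ), f ν := by
  set S := Finset.univ.image fun σ : Equiv.Perm ι => μ ∘ σ with hS
  set c := (Finset.univ.filter fun σ : Equiv.Perm ι => μ ∘ σ = μ).card
  have hfib : ∀ ν ∈ S, (Finset.univ.filter fun σ : Equiv.Perm ι => μ ∘ σ = ν).card = c := by
    intro ν hν
    obtain ⟨τ, -, rfl⟩ := Finset.mem_image.1 hν
    refine Finset.card_equiv (Equiv.mulRight τ⁻¹) fun σ => ?_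
    simp only [Finset.mem_filter, Finset.mem_univ, true_and, Equiv.coe_mulRight,
      Equiv.Perm.coe_mul, ← Function.comp_assoc]
    rw [Equiv.Perm.inv_def, Equiv.comp_symm_eq]
  have hsum : ∀ g : (ι → α) → ℝ, ∑ σ : Equiv.Perm ι, g (μ ∘ σ) = c * ∑ ν ∈ S, g ν := by
    intro g
    rw [Finset.sum_comp g fun σ : Equiv.Perm ι => μ ∘ σ, Finset.mul_sum]
    exact Finset.sum_congr rfl fun ν hν => by rw [hfib ν hν, nsmul_eq_mul]
  have hone := hsum fun _ => 1
  simp only [Finset.sum_const, Finset.card_univ, Fintype.card_perm, nsmul_eq_mul, mul_one] at hone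
  rw [hsum f, hone]
  ring

/-- The weakly decreasing rearrangement of a tuple. -/
def antitoneSort {n : ℕ} (ν : Fin n → ℕ) : {μ : Fin n → ℕ // Antitone μ} :=
  ⟨ν ∘ Tuple.sort (OrderDual.toDual ∘ ν),
    monotone_toDual_comp_iff.1 (Tuple.monotone_sort (OrderDual.toDual ∘ ν))⟩

theorem antitoneSort_eq_iff {n : ℕ} (ν : Fin n → ℕ) (μ : {μ : Fin n → ℕ // Antitone μ}) :
    antitoneSort ν = μ ↔ ν ∈ Finset.univ.image fun σ : Equiv.Perm (Fin n) => μ.1 ∘ σ := by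
  simp only [Finset.mem_image, Finset.mem_univ, true_and]
  constructor
  · rintro rfl
    refine ⟨(Tuple.sort (OrderDual.toDual ∘ ν))⁻¹, ?_⟩
    ext i
    simp [antitoneSort]
  · rintro ⟨σ, rfl⟩
    have hμ : Antitone (μ.1 ∘ (1 : Equiv.Perm (Fin n))) := μ.2
    have hs := (antitoneSort (μ.1 ∘ σ)).2
    refine Subtype.ext ?_
    simp only [antitoneSort, Function.comp_assoc, ← Equiv.Perm.coe_mul] at hs ⊢
    exact Tuple.unique_antitone hs hμ

theorem sum_perm_prod_pow_comp {ι : Type*} [Fintype ι] [DecidableEq ι] (x : ι → ℝ) (μ : ι → ℕ)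
    (τ : Equiv.Perm ι) :
    ∑ σ : Equiv.Perm ι, ∏ j, x j ^ (μ ∘ τ) (σ j) = ∑ σ : Equiv.Perm ι, ∏ j, x j ^ μ (σ j) :=
  Fintype.sum_equiv (Equiv.mulLeft τ) _ _ fun _ => rfl

theorem sum_perm_prod_comp_pow {ι : Type*} [Fintype ι] [DecidableEq ι] (x : ι → ℝ) (ν : ι → ℕ) :
    ∑ ρ : Equiv.Perm ι, ∏ j, x (ρ j) ^ ν j = ∑ σ : Equiv.Perm ι, ∏ j, x j ^ ν (σ j) :=
  Fintype.sum_equiv (Equiv.inv _) _ _ fun ρ =>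
    Fintype.prod_equiv ρ _ _ fun j => by simp

theorem hasSum_sum_perm_exp {n : ℕ} (x y : Fin n → ℝ) :
    HasSum (fun ν : Fin n → ℕ => (∑ σ : Equiv.Perm (Fin n), ∏ j, x j ^ ν (σ j))
        * ((∏ j, y j ^ ν j) / ∏ j, ((ν j).factorial : ℝ)))
      (∑ ρ : Equiv.Perm (Fin n), Real.exp (∑ j, x (ρ j) * y j)) := by
  have hexp : ∀ t : ℝ, HasSum (fun k : ℕ => t ^ k / (k.factorial : ℝ)) (Real.exp t) := fun t => by
    rw [Real.exp_eq_exp_ℝ]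
    exact NormedSpace.expSeries_div_hasSum_exp t
  have h := hasSum_sum (s := Finset.univ) fun (ρ : Equiv.Perm (Fin n)) _ =>
    hasSum_pi_prod fun j => hexp (x (ρ j) * y j)
  simp only [← Real.exp_sum] at h
  refine h.congr_fun fun ν => ?_
  rw [← sum_perm_prod_comp_pow, Finset.sum_mul]
  refine Finset.sum_congr rfl fun ρ _ => ?_
  simp only [mul_pow, Finset.prod_div_distrib, Finset.prod_mul_distrib, mul_div_assoc]

theorem hasSum_antitone_sum_perm_exp {n : ℕ} (x y : Fin n → ℝ) :
    HasSum (fun μ : {μ : Fin n → ℕ // Antitone μ} =>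
      (((Finset.univ.image fun σ : Equiv.Perm (Fin n) => μ.1 ∘ σ).card : ℝ)
          / ((Nat.factorial n : ℝ) * ∏ j, (Nat.factorial (μ.1 j) : ℝ)))
        * (∑ σ : Equiv.Perm (Fin n), ∏ j, x j ^ μ.1 (σ j))
        * (∑ σ : Equiv.Perm (Fin n), ∏ j, y j ^ μ.1 (σ j)))
      (∑ ρ : Equiv.Perm (Fin n), Real.exp (∑ j, x (ρ j) * y j)) := by
  refine ((hasSum_sum_perm_exp x y).tsum_fiberwise antitoneSort).congr_fun fun μ => ?_
  have hset : antitoneSort ⁻¹' {μ}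
      = ↑(Finset.univ.image fun σ : Equiv.Perm (Fin n) => μ.1 ∘ σ) := by
    ext ν
    simpa using antitoneSort_eq_iff ν μ
  have havg := card_image_comp_perm_mul_sum μ.1 fun ν => ∏ j, y j ^ ν j
  rw [hset, Finset.tsum_subtype' _ fun ν : Fin n → ℕ =>
    (∑ σ : Equiv.Perm (Fin n), ∏ j, x j ^ ν (σ j))
      * ((∏ j, y j ^ ν j) / ∏ j, ((ν j).factorial : ℝ))]
  have hterm : ∀ ν ∈ Finset.univ.image (fun σ : Equiv.Perm (Fin n) => μ.1 ∘ σ),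
      (∑ σ : Equiv.Perm (Fin n), ∏ j, x j ^ ν (σ j))
          * ((∏ j, y j ^ ν j) / ∏ j, ((ν j).factorial : ℝ))
        = (∑ σ : Equiv.Perm (Fin n), ∏ j, x j ^ μ.1 (σ j))
          / (∏ j, ((μ.1 j).factorial : ℝ)) * ∏ j, y j ^ ν j := by
    intro ν hν
    obtain ⟨τ, -, rfl⟩ := Finset.mem_image.1 hν
    have hfac : ∏ j, (((μ.1 ∘ τ) j).factorial : ℝ) = ∏ j, ((μ.1 j).factorial : ℝ) :=
      Equiv.prod_comp τ fun j => ((μ.1 j).factorial : ℝ)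
    rw [sum_perm_prod_pow_comp, hfac]
    ring
  rw [Finset.sum_congr rfl hterm, ← Finset.mul_sum]
  simp only [Fintype.card_fin, Function.comp_apply] at havg
  have hn : (n.factorial : ℝ) ≠ 0 := by positivity
  have hμ : ∏ j, ((μ.1 j).factorial : ℝ) ≠ 0 := by positivity
  field_simp
  linear_combination (∑ σ : Equiv.Perm (Fin n), ∏ j, x j ^ μ.1 (σ j)) * havg

/-- Expansion of the symmetrized exponential `∑_{ρ∈S_N} e^{ρx·y}` in terms of
monomial symmetric functions: the sum over weakly decreasing `μ ∈ ℕ^N` of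
`[M(μ,N)/(N!·∏ μ_j!)]·(∑_σ ∏_j x_j^{μ_{σ(j)}})·(∑_σ ∏_j y_j^{μ_{σ(j)}})`
converges absolutely and equals `∑_{ρ∈S_N} exp(∑_j x_{ρ(j)} y_j)`.
Here `M(μ,N)` is the number of distinct permutations of `μ`. -/
theorem stmt_13 (N : ℕ) (hN : 1 ≤ N) (x y : Fin N → ℝ) :
    Summable (fun μ : {μ : Fin N → ℕ // Antitone μ} =>
      (((Finset.univ.image fun σ : Equiv.Perm (Fin N) => μ.1 ∘ σ).card : ℝ)
          / ((Nat.factorial N : ℝ) * ∏ j, (Nat.factorial (μ.1 j) : ℝ)))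
        * (∑ σ : Equiv.Perm (Fin N), ∏ j, x j ^ μ.1 (σ j))
        * (∑ σ : Equiv.Perm (Fin N), ∏ j, y j ^ μ.1 (σ j)))
    ∧ ∑ ρ : Equiv.Perm (Fin N), Real.exp (∑ j, x (ρ j) * y j)
      = ∑' μ : {μ : Fin N → ℕ // Antitone μ},
        (((Finset.univ.image fun σ : Equiv.Perm (Fin N) => μ.1 ∘ σ).card : ℝ)
            / ((Nat.factorial N : ℝ) * ∏ j, (Nat.factorial (μ.1 j) : ℝ)))
          * (∑ σ : Equiv.Perm (Fin N), ∏ j, x j ^ μ.1 (σ j))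
          * (∑ σ : Equiv.Perm (Fin N), ∏ j, y j ^ μ.1 (σ j)) := by
  exact ⟨(hasSum_antitone_sum_perm_exp x y).summable,
    (hasSum_antitone_sum_perm_exp x y).tsum_eq.symm⟩
end

section
/- Let N ≥ 2 and let τ = (τ_1 ≥ τ_2 ≥ … ≥ τ_L > 0) be an integer partition whose length L satisfies 2 ≤ L ≤ N, and define its conjugate by τ'_j = #{ i : 1 ≤ i ≤ L and τ_i ≥ j }. Then the limit as the real parameter k → ∞ of the finite product ∏_{i=1}^{L} ∏_{j=1}^{τ_i} (τ_i − j + k(τ'_j − i + 1)) / [ (k(N − i + 1) + j − 1)(τ_i − j + 1 + k(τ'_j − i)) ] exists and equals 0. -/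
open Filter

theorem tendsto_affine_div_affine_atTop (a b d : ℝ) {c : ℝ} (hc : c ≠ 0) :
    Tendsto (fun k : ℝ => (a + k * b) / (k * c + d)) atTop (nhds (b / c)) := by
  have hinv := tendsto_inv_atTop_zero (𝕜 := ℝ)
  have h : Tendsto (fun k : ℝ => (a * k⁻¹ + b) / (c + d * k⁻¹)) atTop
      (nhds ((a * 0 + b) / (c + d * 0))) :=
    ((hinv.const_mul a).add_const b).div ((hinv.const_mul d).const_add c) (by simpa using hc)
  simp only [mul_zero, zero_add, add_zero] at h
  refine h.congr' ?_
  filter_upwards [eventually_gt_atTop 0] with k hk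
  have hk' : k ≠ 0 := hk.ne'
  rw [← mul_div_mul_left _ _ hk']
  congr 1 <;> field_simp

theorem tendsto_affine_div_affine_mul_affine_atTop (a b d e : ℝ) {c f : ℝ} (hc : c ≠ 0)
    (hf : 0 ≤ f) :
    Tendsto (fun k : ℝ => (a + k * b) / ((k * c + d) * (e + k * f))) atTop
      (nhds (if f = 0 then b / c * e⁻¹ else 0)) := by
  have h := tendsto_affine_div_affine_atTop a b d hc
  have hfactor (k : ℝ) : (a + k * b) / ((k * c + d) * (e + k * f)) =
      (a + k * b) / (k * c + d) * (e + k * f)⁻¹ := by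
    rw [← div_div, div_eq_mul_inv (_ / _)]
  simp only [hfactor]
  split_ifs with hf0
  · simpa [hf0] using h.mul_const e⁻¹
  · have hinv : Tendsto (fun k : ℝ => (e + k * f)⁻¹) atTop (nhds 0) :=
      tendsto_inv_atTop_zero.comp (tendsto_atTop_add_const_left _ e
        (tendsto_id.atTop_mul_const (lt_of_le_of_ne hf (Ne.symm hf0))))
    simpa using h.mul hinv

/-- For a partition `τ` of length `L` with `2 ≤ L ≤ N` and conjugate `τ'`, the
`k → ∞` limit of
`∏_{i=1}^{L} ∏_{j=1}^{τ_i} (τ_i − j + k(τ'_j − i + 1)) /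
  [(k(N − i + 1) + j − 1)(τ_i − j + 1 + k(τ'_j − i))]`
exists and equals `0`. -/
theorem stmt_15 (N L : ℕ) (hN : 2 ≤ N) (hL : 2 ≤ L) (hLN : L ≤ N)
    (τ : ℕ → ℕ)
    (hdec : ∀ i j, 1 ≤ i → i ≤ j → j ≤ L → τ j ≤ τ i)
    (hpos : ∀ i, 1 ≤ i → i ≤ L → 0 < τ i)
    (τ' : ℕ → ℕ)
    (hconj : ∀ j, τ' j = ((Finset.Icc 1 L).filter fun i => j ≤ τ i).card) :
    Tendsto
      (fun k : ℝ => ∏ i ∈ Finset.Icc 1 L, ∏ j ∈ Finset.Icc 1 (τ i),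
        ((τ i : ℝ) - (j : ℝ) + k * ((τ' j : ℝ) - (i : ℝ) + 1))
          / ((k * ((N : ℝ) - (i : ℝ) + 1) + (j : ℝ) - 1)
            * ((τ i : ℝ) - (j : ℝ) + 1 + k * ((τ' j : ℝ) - (i : ℝ)))))
      atTop (nhds 0) := by
  have hfactor : ∀ i ∈ Finset.Icc 1 L, ∀ j ∈ Finset.Icc 1 (τ i), Tendsto
      (fun k : ℝ => ((τ i : ℝ) - (j : ℝ) + k * ((τ' j : ℝ) - (i : ℝ) + 1))
          / ((k * ((N : ℝ) - (i : ℝ) + 1) + (j : ℝ) - 1)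
            * ((τ i : ℝ) - (j : ℝ) + 1 + k * ((τ' j : ℝ) - (i : ℝ)))))
      atTop (nhds (if (τ' j : ℝ) - i = 0 then
        ((τ' j : ℝ) - i + 1) / ((N : ℝ) - i + 1) * ((τ i : ℝ) - j + 1)⁻¹ else 0)) := by
    intro i hi j hj
    rw [Finset.mem_Icc] at hi hj
    have hle : i ≤ τ' j := by
      rw [hconj]
      calc i = (Finset.Icc 1 i).card := by simp
        _ ≤ _ := by
          refine Finset.card_le_card fun m hm => ?_
          rw [Finset.mem_Icc] at hm
          rw [Finset.mem_filter, Finset.mem_Icc]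
          exact ⟨⟨hm.1, hm.2.trans hi.2⟩, hj.2.trans (hdec m i hm.1 hm.2 hi.2)⟩
    have hle' : (i : ℝ) ≤ τ' j := by exact_mod_cast hle
    have hiN : (i : ℝ) ≤ N := by exact_mod_cast hi.2.trans hLN
    simp only [add_sub_assoc _ (j : ℝ) 1]
    exact tendsto_affine_div_affine_mul_affine_atTop _ _ _ _ (by linarith) (by linarith)
  have h := tendsto_finsetProd (Finset.Icc 1 L) fun i hi =>
    tendsto_finsetProd (Finset.Icc 1 (τ i)) (hfactor i hi)
  have hconj_one : τ' 1 = L := by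
    rw [hconj, Finset.filter_true_of_mem, Nat.card_Icc, Nat.add_sub_cancel]
    intro i hi
    rw [Finset.mem_Icc] at hi
    exact hpos i hi.1 hi.2
  have hne : (τ' 1 : ℝ) - (1 : ℕ) ≠ 0 := by
    have : (2 : ℝ) ≤ L := by exact_mod_cast hL
    rw [hconj_one, Nat.cast_one]
    linarith
  rwa [Finset.prod_eq_zero (i := 1) (Finset.mem_Icc.2 ⟨le_rfl, by omega⟩)
    (Finset.prod_eq_zero (i := 1) (Finset.mem_Icc.2 ⟨le_rfl, hpos 1 le_rfl (by omega)⟩)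
      (if_neg hne))] at h
end

section
/- Let N ≥ 2 and k ≥ 0, and for j = 1,…,N define L_j : ℝ^N → ℝ by L_j(x) = (x_j + k∑_{m=1}^N x_m)/(1 + Nk). Then for every i, j and every x ∈ ℝ^N with pairwise distinct coordinates, the type-A Dunkl operator satisfies T_i L_j(x) = ∂L_j/∂x_i(x) + k ∑_{l≠i} [L_j(x) − L_j(σ_{il}x)]/(x_i − x_l) = δ_{ij}. Consequently L_j is the image of the monomial x_j under the type-A intertwining operator V_k, since T_i L_j = δ_{ij} = V_k(∂x_j/∂x_i) and L_j is homogeneous of degree one. -/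
/-- `V_k x_j`, the image of the monomial `x_j` under the type-A intertwining
operator: `L_j(x) = (x_j + k ∑_m x_m)/(1 + Nk)`. -/
noncomputable def Lfun (N : ℕ) (k : ℝ) (j : Fin N) (x : Fin N → ℝ) : ℝ :=
  (x j + k * ∑ m, x m) / (1 + N * k)

theorem fderiv_Lfun_single (N : ℕ) (k : ℝ) (i j : Fin N) (x : Fin N → ℝ) :
    fderiv ℝ (Lfun N k j) x (Pi.single i 1) = ((if i = j then 1 else 0) + k) / (1 + N * k) := by
  have h : HasFDerivAt (Lfun N k j)
      ((1 + N * k)⁻¹ • (ContinuousLinearMap.proj (R := ℝ) (φ := fun _ : Fin N => ℝ) j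
        + k • ∑ m, ContinuousLinearMap.proj (R := ℝ) (φ := fun _ : Fin N => ℝ) m)) x := by
    convert ContinuousLinearMap.hasFDerivAt _ using 1
    ext y
    simp [Lfun, sum_apply, div_eq_inv_mul, mul_add]
  rw [h.fderiv]
  simp [sum_apply, Pi.single_apply, div_eq_inv_mul, mul_add, eq_comm]

theorem Lfun_sub_swap_div (N : ℕ) (k : ℝ) {i l : Fin N} (j : Fin N) (x : Fin N → ℝ)
    (hx : x i ≠ x l) :
    (Lfun N k j x - Lfun N k j (x ∘ Equiv.swap i l)) / (x i - x l)
      = ((if i = j then 1 else 0) - (if l = j then 1 else 0)) / (1 + N * k) := by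
  have hsum : ∑ m, (x ∘ Equiv.swap i l) m = ∑ m, x m := Equiv.sum_comp (Equiv.swap i l) x
  have hil : i ≠ l := fun h => hx (congrArg x h)
  have hsub : x i - x l ≠ 0 := sub_ne_zero.mpr hx
  have hcoord : x j - x (Equiv.swap i l j)
      = ((if i = j then 1 else 0) - (if l = j then 1 else 0)) * (x i - x l) := by
    by_cases hi : i = j
    · subst hi
      simp [hil.symm]
    · by_cases hl : l = j
      · subst hl
        simp [hil]
      · simp [hi, hl, Equiv.swap_apply_of_ne_of_ne (Ne.symm hi) (Ne.symm hl)]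
  rw [Lfun, Lfun, hsum, ← sub_div, add_sub_add_right_eq_sub, Function.comp_apply, hcoord,
    div_right_comm, mul_div_cancel_right₀ _ hsub]


/-- The type-A Dunkl operator applied to `L_j(x) = (x_j + k∑_m x_m)/(1 + Nk)`
gives `T_i L_j = δ_{ij}` at every point with pairwise distinct coordinates. -/
theorem stmt_16 (N : ℕ) (hN : 2 ≤ N) (k : ℝ) (hk : 0 ≤ k) :
    ∀ (i j : Fin N) (x : Fin N → ℝ), Function.Injective x →
      fderiv ℝ (Lfun N k j) x (Pi.single i 1)
        + k * ∑ l ∈ Finset.univ.erase i,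
            (Lfun N k j x - Lfun N k j (x ∘ Equiv.swap i l)) / (x i - x l)
      = if i = j then 1 else 0 := by
  intro i j x hx
  have hN1 : (1 + N * k : ℝ) ≠ 0 := by positivity
  rw [fderiv_Lfun_single, Finset.sum_congr rfl fun l hl =>
    Lfun_sub_swap_div N k j x (hx.ne (Finset.ne_of_mem_erase hl).symm), ← Finset.sum_div,
    Finset.sum_erase _ (by simp)]
  simp only [Finset.sum_sub_distrib, Finset.sum_const, Finset.card_univ, Fintype.card_fin,
    Finset.sum_ite_eq', Finset.mem_univ, if_true, nsmul_eq_mul]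
  field_simp
  ring
end
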